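/- Let (x_i, y_i), 0 ≤ i ≤ n−1, be a time series, N ≥ 1 a bound on polynomial degrees, and for 0 ≤ p ≤ q ≤ n and 0 ≤ d < N let E(p, q, d) be the minimal squared l₂ fit error of a degree-at-most-d polynomial over index range [p, q). For r ≥ 0 and 0 ≤ q ≤ n, let R(r, q) denote the minimal total error ∑_{j=1}^κ E(z_{j−1}, z_j, d_j) over all segmentations 0 = z_0 < z_1 < … < z_κ = q with degrees d_j ∈ {0, …, N−1} of total complexity ∑_{j=1}^κ (d_j + 1) = r (with R(0, 0) = 0, and R(r, q) = +∞ when no such segmentation exists). Then the Bellman recurrence holds: for q ≥ 1 and r ≥ 1, R(r, q) = min over 0 ≤ p < q and 0 ≤ d < N with d + 1 ≤ r of R(r − d − 1, p) + E(p, q, d). -/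

import Mathlib

/-- `fitError x y p q d` is the minimal squared `l₂` fit error of a polynomial
of degree at most `d` over the index range `[p, q)`. -/
noncomputable def fitError (x y : ℕ → ℝ) (p q d : ℕ) : ℝ :=
  sInf {e : ℝ | ∃ P : Polynomial ℝ, P.natDegree ≤ d ∧
    e = ∑ i ∈ Finset.Ico p q, (P.eval (x i) - y i) ^ 2}

/-- `optCost x y N r q` is the minimal total error of a segmentation of the
first `q` points into intervals `[z_{j-1}, z_j)` with degrees `d_j < N` and
total complexity `∑_j (d_j + 1)` exactly `r`; it is `+∞` (`sInf ∅` in `EReal`)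
when no such segmentation exists, and `optCost x y N 0 0 = 0` (via the empty
segmentation). -/
noncomputable def optCost (x y : ℕ → ℝ) (N r q : ℕ) : EReal :=
  sInf {v : EReal | ∃ (κ : ℕ) (z : ℕ → ℕ) (d : ℕ → ℕ),
    z 0 = 0 ∧ z κ = q ∧ (∀ j < κ, z j < z (j + 1)) ∧ (∀ j < κ, d j < N) ∧
    (∑ j ∈ Finset.range κ, (d j + 1)) = r ∧
    v = ((∑ j ∈ Finset.range κ, fitError x y (z j) (z (j + 1)) (d j) : ℝ) : EReal)}

/-- Appending the interval `[p, q)` fitted with degree `d` to an optimal segmentation of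
the first `p` points gives an upper bound for the optimal cost at `q`. -/
theorem optCost_le_add_fitError (x y : ℕ → ℝ) {N s p q d : ℕ} (hpq : p < q) (hd : d < N) :
    optCost x y N (s + (d + 1)) q ≤ optCost x y N s p + ((fitError x y p q d : ℝ) : EReal) := by
  rw [← EReal.sub_le_iff_le_add (.inl (EReal.coe_ne_bot _)) (.inl (EReal.coe_ne_top _))]
  refine le_sInf ?_
  rintro _ ⟨κ, z, e, hz0, hzκ, hz, he, hs, rfl⟩
  rw [EReal.sub_le_iff_le_add (.inl (EReal.coe_ne_bot _)) (.inl (EReal.coe_ne_top _))]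
  have hz' : ∀ j ≤ κ, (if j ≤ κ then z j else q) = z j := fun j hj => if_pos hj
  have he' : ∀ j < κ, (if j < κ then e j else d) = e j := fun j hj => if_pos hj
  refine sInf_le ⟨κ + 1, fun j => if j ≤ κ then z j else q, fun j => if j < κ then e j else d,
    by simpa using hz0, by simp, fun j hj => ?_, fun j hj => ?_, ?_, ?_⟩
  · rcases (Nat.lt_succ_iff_lt_or_eq.mp hj) with h | rfl
    · simpa [h.le, Nat.succ_le_of_lt h] using hz j h
    · simpa [hzκ] using hpq
  · dsimp only
    split_ifs with h
    exacts [he j h, hd]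
  · rw [Finset.sum_range_succ, ← hs]
    simp only [lt_irrefl, if_false]
    congr 1
    exact Finset.sum_congr rfl fun j hj => by rw [he' j (Finset.mem_range.mp hj)]
  · rw [Finset.sum_range_succ, ← EReal.coe_add]
    congr 2
    · refine Finset.sum_congr rfl fun j hj => ?_
      have hj := Finset.mem_range.mp hj
      dsimp only
      rw [hz' j hj.le, hz' (j + 1) hj, he' j hj]
    · simp [hzκ]

/-- Bellman recurrence for the optimal adaptive segmentation cost: for
`q ≥ 1` and `r ≥ 1`,
`R(r, q) = min_{0 ≤ p < q, 0 ≤ d < N, d + 1 ≤ r} R(r − d − 1, p) + E(p, q, d)`. -/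
theorem optCost_bellman (x y : ℕ → ℝ) (hx : StrictMono x) (n N : ℕ) (hN : 1 ≤ N)
    (r q : ℕ) (hr : 1 ≤ r) (hq : 1 ≤ q) (hqn : q ≤ n) :
    optCost x y N r q
      = sInf {v : EReal | ∃ (p d : ℕ), p < q ∧ d < N ∧ d + 1 ≤ r ∧
          v = optCost x y N (r - d - 1) p + ((fitError x y p q d : ℝ) : EReal)} := by
  apply le_antisymm
  · refine le_sInf ?_
    rintro _ ⟨p, d, hpq, hd, hdr, rfl⟩
    have h := optCost_le_add_fitError x y (s := r - d - 1) hpq hd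
    rwa [show r - d - 1 + (d + 1) = r by omega] at h
  · refine le_sInf ?_
    rintro _ ⟨κ, z, d, hz0, hzκ, hz, hd, hs, rfl⟩
    obtain _ | κ := κ
    · omega
    rw [Finset.sum_range_succ] at hs
    rw [Finset.sum_range_succ, EReal.coe_add, hzκ]
    refine sInf_le_of_le ⟨z κ, d κ, hzκ ▸ hz κ κ.lt_succ_self, hd κ κ.lt_succ_self, by omega,
      rfl⟩ ?_
    gcongr
    exact sInf_le ⟨κ, z, d, hz0, rfl, fun j hj => hz j (hj.trans κ.lt_succ_self),
      fun j hj => hd j (hj.trans κ.lt_succ_self), by omega, rfl⟩
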